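/- Let ν ≥ 0, α > 0, β > 0, and let f : (0,∞) → ℝ be smooth with compact support contained in (0,∞). Then the fractional Bessel derivatives satisfy the semigroup property: for every x > 0, (DB_{ν,-}^α (DB_{ν,-}^β f))(x) = (DB_{ν,-}^{α+β} f)(x). -/

import Mathlib

open MeasureTheory Set

/-- Gauss hypergeometric function ₂F₁(a,b;c;z) defined by its power series. -/
noncomputable def gaussHyp (a b c z : ℝ) : ℝ :=
  ∑' n : ℕ, ((ascPochhammer ℝ n).eval a * (ascPochhammer ℝ n).eval b /
    ((ascPochhammer ℝ n).eval c * (n.factorial : ℝ))) * z ^ n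

/-- Fractional Bessel integral on the semiaxis. -/
noncomputable def IB (ν α : ℝ) (f : ℝ → ℝ) (x : ℝ) : ℝ :=
  (1 / Real.Gamma (2 * α)) *
    ∫ y in Ioi x, ((y ^ 2 - x ^ 2) / (2 * y)) ^ (2 * α - 1) *
      gaussHyp (α + (ν - 1) / 2) α (2 * α) (1 - x ^ 2 / y ^ 2) * f y

/-- Bessel operator B_ν g = g'' + (ν/x) g'. -/
noncomputable def besselOp (ν : ℝ) (g : ℝ → ℝ) (x : ℝ) : ℝ :=
  deriv (deriv g) x + (ν / x) * deriv g x

/-- Fractional Bessel derivative DB_{ν,-}^α f = B_ν^n (IB_{ν,-}^{n-α} f), n = ⌊α⌋ + 1. -/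
noncomputable def DB (ν α : ℝ) (f : ℝ → ℝ) : ℝ → ℝ :=
  (besselOp ν)^[Nat.floor α + 1] (IB ν ((Nat.floor α + 1 : ℕ) - α) f)


lemma aux_binom (a w : ℝ) (hw : |w| < 1) :
    HasSum (fun n : ℕ => (ascPochhammer ℝ n).eval a / (n.factorial : ℝ) * w ^ n)
      ((1 - w) ^ (-a)) := by
  have h := (Real.one_div_one_sub_rpow_hasFPowerSeriesOnBall_zero a).hasSum (y := w)
    (by simpa [enorm_eq_nnnorm] using! hw)
  have h1 : w < 1 := (abs_lt.1 hw).2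
  rw [Real.rpow_neg (by linarith), ← one_div]
  have e : (fun n : ℕ => (ascPochhammer ℝ n).eval a / (n.factorial : ℝ) * w ^ n) =
      fun n : ℕ => (FormalMultilinearSeries.ofScalars ℝ
        (fun n : ℕ ↦ Ring.choose (a + n - 1) n) n) fun _ => w := by
    ext n
    rw [FormalMultilinearSeries.ofScalars_apply_eq, ← Ring.multichoose_eq, smul_eq_mul]
    congr 1
    have := Ring.factorial_nsmul_multichoose_eq_ascPochhammer a n
    rw [Polynomial.ascPochhammer_smeval_eq_eval] at this
    rw [← this, nsmul_eq_mul]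
    field_simp
  rw [e]
  simpa using h

lemma aux_gamma_poch (b : ℝ) (hb : 0 < b) (n : ℕ) :
    Real.Gamma (b + n) = (ascPochhammer ℝ n).eval b * Real.Gamma b := by
  induction n with
  | zero => simp
  | succ n ih =>
    push_cast
    rw [← add_assoc, Real.Gamma_add_one (by positivity), ih, ascPochhammer_succ_eval]
    ring

lemma aux_beta_l (b d : ℝ) (hb : 0 < b) (hd : 0 < d) :
    ∫⁻ x in Ioo (0:ℝ) 1, ENNReal.ofReal (x ^ (b - 1) * (1 - x) ^ (d - 1)) =
      ENNReal.ofReal (ProbabilityTheory.beta b d) := by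
  have h := ProbabilityTheory.lintegral_betaPDF_eq_one hb hd
  rw [ProbabilityTheory.lintegral_betaPDF] at h
  have hp := ProbabilityTheory.beta_pos hb hd
  have : ∀ x : ℝ, ENNReal.ofReal (1 / ProbabilityTheory.beta b d * x ^ (b - 1) * (1 - x) ^ (d - 1))
     = ENNReal.ofReal (1 / ProbabilityTheory.beta b d) *
      ENNReal.ofReal (x ^ (b - 1) * (1 - x) ^ (d - 1)) := by
    intro x
    rw [mul_assoc, ENNReal.ofReal_mul (by positivity)]
  simp_rw [this] at h
  rw [lintegral_const_mul _ (by fun_prop)] at h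
  calc _ = ENNReal.ofReal (ProbabilityTheory.beta b d) * (ENNReal.ofReal (1 / ProbabilityTheory.beta b d) *
      ∫⁻ x in Ioo (0:ℝ) 1, ENNReal.ofReal (x ^ (b - 1) * (1 - x) ^ (d - 1))) := by
        rw [← mul_assoc, ← ENNReal.ofReal_mul hp.le, mul_one_div_cancel hp.ne']; simp
    _ = _ := by rw [h, mul_one]

lemma aux_beta_nonneg (b d : ℝ) : 0 ≤ᵐ[volume.restrict (Ioo (0:ℝ) 1)]
    fun x : ℝ => x ^ (b - 1) * (1 - x) ^ (d - 1) := by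
  refine ae_restrict_of_forall_mem measurableSet_Ioo (fun x hx ↦ ?_)
  have := hx.1
  have : 0 < 1 - x := by linarith [hx.2]
  simp only [Pi.zero_apply]
  positivity

lemma aux_beta_int (b d : ℝ) (hb : 0 < b) (hd : 0 < d) :
    IntegrableOn (fun x : ℝ => x ^ (b - 1) * (1 - x) ^ (d - 1)) (Ioo 0 1) := by
  refine ⟨Measurable.aestronglyMeasurable (by fun_prop), ?_⟩
  rw [hasFiniteIntegral_iff_ofReal (aux_beta_nonneg b d), aux_beta_l b d hb hd]
  exact ENNReal.ofReal_lt_top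

lemma aux_beta (b d : ℝ) (hb : 0 < b) (hd : 0 < d) :
    ∫ x in Ioo (0:ℝ) 1, x ^ (b - 1) * (1 - x) ^ (d - 1) = ProbabilityTheory.beta b d := by
  rw [integral_eq_lintegral_of_nonneg_ae (aux_beta_nonneg b d)
    (Measurable.aestronglyMeasurable (by fun_prop)), aux_beta_l b d hb hd,
    ENNReal.toReal_ofReal (ProbabilityTheory.beta_pos hb hd).le]

/-- Euler integral. -/
lemma aux_euler (a b d z : ℝ) (hb : 0 < b) (hd : 0 < d) (hz0 : 0 ≤ z) (hz1 : z < 1) :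
    IntegrableOn (fun x : ℝ => x ^ (b - 1) * (1 - x) ^ (d - 1) * (1 - z * x) ^ (-a)) (Ioo 0 1) ∧
    ∫ x in Ioo (0:ℝ) 1, x ^ (b - 1) * (1 - x) ^ (d - 1) * (1 - z * x) ^ (-a) =
      ProbabilityTheory.beta b d * gaussHyp a b (b + d) z := by
  set c : ℕ → ℝ := fun n => (ascPochhammer ℝ n).eval a / (n.factorial : ℝ) with hc
  set F : ℕ → ℝ → ℝ := fun n x => x ^ (b - 1) * (1 - x) ^ (d - 1) * (c n * (z * x) ^ n) with hF
  have hFeq : ∀ n, ∀ x ∈ Ioo (0:ℝ) 1,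
      F n x = c n * z ^ n * (x ^ (b + n - 1) * (1 - x) ^ (d - 1)) := by
    intro n x hx
    have : x ^ (b + n - 1) = x ^ (b - 1) * x ^ n := by
      rw [← Real.rpow_natCast x n, ← Real.rpow_add hx.1]; ring_nf
    simp only [hF, this, mul_pow]; ring
  have hint : ∀ n, IntegrableOn (F n) (Ioo 0 1) := by
    intro n
    have := ((aux_beta_int (b + n) d (by positivity) hd).const_mul (c n * z ^ n))
    exact IntegrableOn.congr_fun this (fun x hx => (hFeq n x hx).symm) measurableSet_Ioo
  have hval : ∀ n, ∫ x in Ioo (0:ℝ) 1, F n x = c n * z ^ n * ProbabilityTheory.beta (b + n) d := by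
    intro n
    rw [setIntegral_congr_fun measurableSet_Ioo (hFeq n), integral_const_mul,
      aux_beta _ _ (by positivity) hd]
  have hsum0 : Summable (fun n => |c n * z ^ n|) :=
    (aux_binom a z (by rwa [abs_of_nonneg hz0])).summable.abs
  have hptsum : ∀ x ∈ Ioo (0:ℝ) 1, HasSum (fun n => F n x)
      (x ^ (b - 1) * (1 - x) ^ (d - 1) * (1 - z * x) ^ (-a)) := by
    intro x hx
    have hzx : |z * x| < 1 := by
      rw [abs_of_nonneg (mul_nonneg hz0 hx.1.le)]
      nlinarith [hx.1, hx.2]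
    exact (aux_binom a (z * x) hzx).mul_left _
  have hnorm : ∀ n, ∫ x in Ioo (0:ℝ) 1, ‖F n x‖ ≤ |c n * z ^ n| * ProbabilityTheory.beta b d := by
    intro n
    rw [← aux_beta b d hb hd, ← integral_const_mul]
    refine setIntegral_mono_on (hint n).norm ((aux_beta_int b d hb hd).const_mul _)
      measurableSet_Ioo ?_
    intro x hx
    have h1 := hx.1
    have h2 : 0 < 1 - x := by linarith [hx.2]
    rw [hF]
    simp only [norm_mul, Real.norm_eq_abs, mul_pow, abs_mul]
    rw [abs_of_nonneg (show (0:ℝ) ≤ x ^ (b-1) by positivity),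
      abs_of_nonneg (show (0:ℝ) ≤ (1-x) ^ (d-1) by positivity), abs_of_nonneg (show (0:ℝ) ≤ x ^ n by positivity)]
    have : x ^ n ≤ 1 := pow_le_one₀ h1.le hx.2.le
    calc _ = (|c n| * |z ^ n| * (x ^ (b - 1) * (1 - x) ^ (d - 1))) * x ^ n := by ring
      _ ≤ _ := mul_le_of_le_one_right (by positivity) this
  have hnormsum : Summable (fun n => ∫ x in Ioo (0:ℝ) 1, ‖F n x‖) :=
    Summable.of_nonneg_of_le (fun n => integral_nonneg fun _ => norm_nonneg _) hnorm
      (hsum0.mul_right _)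
  have key := hasSum_integral_of_summable_integral_norm hint hnormsum
  have hcongr : ∫ x in Ioo (0:ℝ) 1, ∑' n, F n x =
      ∫ x in Ioo (0:ℝ) 1, x ^ (b - 1) * (1 - x) ^ (d - 1) * (1 - z * x) ^ (-a) :=
    setIntegral_congr_fun measurableSet_Ioo fun x hx => (hptsum x hx).tsum_eq
  constructor
  · -- integrable: bounded factor
    refine (aux_beta_int b d hb hd).mul_bdd (c := max 1 ((1 - z) ^ (-a)))
      (Measurable.aestronglyMeasurable (by fun_prop)) ?_
    refine ae_restrict_of_forall_mem measurableSet_Ioo (fun x hx ↦ ?_)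
    have h3 : 1 - z ≤ 1 - z * x := by nlinarith [hx.1, hx.2]
    have h4 : 1 - z * x ≤ 1 := by nlinarith [hx.1, hx.2]
    have h5 : 0 < 1 - z := by linarith
    rw [Real.norm_of_nonneg (Real.rpow_nonneg (by linarith) _)]
    rcases le_total 0 a with ha | ha
    · exact le_max_of_le_right (Real.rpow_le_rpow_of_nonpos h5 h3 (by linarith))
    · exact le_max_of_le_left (Real.rpow_le_one (by linarith) h4 (by linarith))
  · rw [← hcongr, ← key.tsum_eq, gaussHyp, ← tsum_mul_left]
    refine tsum_congr fun n => ?_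
    rw [hval n, ProbabilityTheory.beta, ProbabilityTheory.beta]
    rw [show b + n + d = (b + d) + n by ring, aux_gamma_poch b hb, aux_gamma_poch (b+d) (by positivity), hc]
    have h1 := (Real.Gamma_pos_of_pos (show 0 < b + d by positivity)).ne'
    have h2 : (ascPochhammer ℝ n).eval (b + d) ≠ 0 := (ascPochhammer_pos n _ (by positivity)).ne'
    field_simp

open scoped ENNReal

noncomputable def EK (a : ℝ) : ℝ → ℝ≥0∞ :=
  (Ioi (0:ℝ)).indicator fun t =>
    ENNReal.ofReal (2 ^ (1 - a) / Real.Gamma a * (1 - Real.exp (-(2 * t))) ^ (a - 1))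

noncomputable def SK (c : ℝ) (φ : ℝ → ℝ≥0∞) : ℝ → ℝ≥0∞ :=
  fun t => ENNReal.ofReal (Real.exp (c * t)) * φ t

noncomputable def MK (ν a : ℝ) : ℝ → ℝ≥0∞ := lconvolution (SK (ν - 1) (EK a)) (EK a) volume

@[fun_prop]
lemma measurable_EK (a : ℝ) : Measurable (EK a) :=
  Measurable.indicator (by fun_prop) measurableSet_Ioi

@[fun_prop]
lemma measurable_SK (c : ℝ) (φ : ℝ → ℝ≥0∞) (h : Measurable φ) : Measurable (SK c φ) := by
  unfold SK; fun_prop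

@[fun_prop]
lemma measurable_MK (ν a : ℝ) : Measurable (MK ν a) := by
  unfold MK
  exact measurable_lconvolution _ (by fun_prop) (by fun_prop)

lemma SK_SK (c d : ℝ) (φ : ℝ → ℝ≥0∞) : SK c (SK d φ) = SK (c + d) φ := by
  ext t
  simp only [SK]
  rw [← mul_assoc, ← ENNReal.ofReal_mul (by positivity), ← Real.exp_add]
  ring_nf

lemma SK_conv (c : ℝ) (φ ψ : ℝ → ℝ≥0∞) (hφ : Measurable φ) (hψ : Measurable ψ) :
    SK c (lconvolution φ ψ volume) = lconvolution (SK c φ) (SK c ψ) volume := by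
  ext t
  simp only [SK, lconvolution_def]
  rw [← lintegral_const_mul _ (by fun_prop)]
  refine lintegral_congr fun y => ?_
  have : ENNReal.ofReal (Real.exp (c * t)) = ENNReal.ofReal (Real.exp (c * y)) *
      ENNReal.ofReal (Real.exp (c * (-y + t))) := by
    rw [← ENNReal.ofReal_mul (by positivity), ← Real.exp_add]; ring_nf
  rw [this]; ring

lemma aux_image_Ioo (t z : ℝ) (ht : 0 < t) (hz : z = 1 - Real.exp (-(2 * t))) :
    (fun s => (1 - Real.exp (-(2 * s))) / z) '' Ioo 0 t = Ioo 0 1 := by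
  have hz0 : 0 < z := by
    rw [hz]; have := Real.exp_lt_one_iff.2 (show -(2*t) < 0 by linarith); linarith
  ext τ
  constructor
  · rintro ⟨s, hs, rfl⟩
    have h1 := Real.exp_lt_one_iff.2 (show -(2*s) < 0 by linarith [hs.1])
    have h2 := Real.exp_lt_exp.2 (show -(2*t) < -(2*s) by linarith [hs.2])
    constructor
    · exact div_pos (by linarith) hz0
    · show _ / _ < _
      rw [div_lt_one hz0]; linarith
  · rintro ⟨h0, h1⟩
    have hp : 0 < 1 - z * τ := by
      have : z < 1 := by rw [hz]; linarith [Real.exp_pos (-(2*t))]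
      nlinarith
    refine ⟨-(Real.log (1 - z * τ)) / 2, ⟨?_, ?_⟩, ?_⟩
    · have := Real.log_neg hp (by nlinarith); linarith
    · have : -(2*t) < Real.log (1 - z * τ) := by
        rw [Real.lt_log_iff_exp_lt hp]
        nlinarith
      linarith
    · show (1 - Real.exp (-(2 * (-(Real.log (1 - z * τ)) / 2)))) / z = τ
      rw [show -(2 * (-(Real.log (1 - z * τ)) / 2)) = Real.log (1 - z * τ) by ring, Real.exp_log hp]
      field_simp; ring

lemma aux_conv_lint (a b c t z : ℝ) (ha : 0 < a) (hb : 0 < b) (ht : 0 < t)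
    (hz : z = 1 - Real.exp (-(2 * t))) :
    ∫⁻ s in Ioo 0 t, ENNReal.ofReal (Real.exp (-c * s) * (1 - Real.exp (-(2 * s))) ^ (b - 1) *
      (1 - Real.exp (-(2 * (t - s)))) ^ (a - 1)) =
    ENNReal.ofReal (1 / 2 * z ^ (a + b - 1) * (ProbabilityTheory.beta b a *
      gaussHyp (a - c / 2) b (b + a) z)) := by
  have hz0 : 0 < z := by
    rw [hz]; have := Real.exp_lt_one_iff.2 (show -(2*t) < 0 by linarith); linarith
  have hz1 : z < 1 := by rw [hz]; linarith [Real.exp_pos (-(2*t))]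
  obtain ⟨hi, he⟩ := aux_euler (a - c/2) b a z hb ha hz0.le hz1
  rw [← he]
  have hnn : 0 ≤ᵐ[volume.restrict (Ioo (0:ℝ) 1)]
      fun x : ℝ => x ^ (b - 1) * (1 - x) ^ (a - 1) * (1 - z * x) ^ (-(a - c / 2)) := by
    refine ae_restrict_of_forall_mem measurableSet_Ioo (fun x hx ↦ ?_)
    have := hx.1
    have : 0 < 1 - x := by linarith [hx.2]
    have : 0 < 1 - z * x := by nlinarith [hx.1, hx.2]
    simp only [Pi.zero_apply]
    positivity
  rw [ENNReal.ofReal_mul (by positivity), ofReal_integral_eq_lintegral_ofReal hi hnn,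
    ← aux_image_Ioo t z ht hz,
    lintegral_image_eq_lintegral_abs_deriv_mul (f' := fun s => 2 * Real.exp (-(2 * s)) / z)
      measurableSet_Ioo]
  · rw [← lintegral_const_mul' _ _ ENNReal.ofReal_ne_top]
    refine setLIntegral_congr_fun measurableSet_Ioo fun s hs => ?_
    have h1 := Real.exp_lt_one_iff.2 (show -(2*s) < 0 by linarith [hs.1])
    have h2 := Real.exp_lt_exp.2 (show -(2*t) < -(2*s) by linarith [hs.2])
    have h3 := Real.exp_pos (-(2*s))
    beta_reduce
    rw [abs_of_nonneg (by positivity), ← ENNReal.ofReal_mul (by positivity),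
      ← ENNReal.ofReal_mul (by positivity)]
    congr 1
    set v := Real.exp (-(2*s)) with hv
    have e1 : 1 - Real.exp (-(2 * (t - s))) = z * (1 - (1 - v) / z) / v := by
      have : Real.exp (-(2 * (t - s))) = (1 - z) / v := by
        rw [hz, eq_div_iff h3.ne', hv, ← Real.exp_add]; ring_nf
      rw [this]; field_simp; ring
    have e2 : 1 - z * ((1 - v) / z) = v := by field_simp; ring
    have e3 : Real.exp (-c * s) = v ^ (c / 2) := by
      rw [hv, ← Real.exp_mul]; ring_nf
    have p1 : 0 < 1 - (1 - v) / z := by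
      rw [sub_pos, div_lt_one hz0]; linarith
    rw [e1, e2, e3, Real.div_rpow (by positivity) h3.le, Real.mul_rpow hz0.le p1.le,
      Real.div_rpow (by linarith) hz0.le]
    have e4 : v ^ (-(a - c / 2)) = v ^ (c / 2) / v ^ (a - 1) / v := by
      rw [← Real.rpow_sub h3, ← Real.rpow_sub_one h3.ne']; ring_nf
    have e5 : z ^ (a + b - 1) = z ^ (a - 1) * z ^ (b - 1) * z := by
      rw [← Real.rpow_add hz0, ← Real.rpow_add_one hz0.ne']; ring_nf
    rw [e4, e5]
    have := (Real.rpow_pos_of_pos hz0 (b-1)).ne'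
    field_simp
  · intro s hs
    have : HasDerivAt (fun s => (1 - Real.exp (-(2 * s))) / z)
        (2 * Real.exp (-(2 * s)) / z) s := by
      have := ((((hasDerivAt_id s).const_mul 2).neg.exp).const_sub 1).div_const z
      exact this.congr_deriv (by simp only [id, Pi.neg_apply]; ring)
    exact this.hasDerivWithinAt
  · intro s _ s' _ h
    beta_reduce at h
    rw [div_left_inj' hz0.ne', sub_right_inj, Real.exp_eq_exp] at h
    linarith

lemma aux_conv_of_nonpos (a b c t : ℝ) (ht : t ≤ 0) :
    lconvolution (SK c (EK b)) (EK a) volume t = 0 := by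
  rw [lconvolution_def]
  refine lintegral_eq_zero_of_ae_eq_zero (Filter.Eventually.of_forall fun y => ?_)
  simp only [SK, EK, Pi.zero_apply]
  by_cases hy : 0 < y
  · rw [indicator_of_notMem (a := -y + t), mul_zero]
    simp only [mem_Ioi]; linarith
  · rw [indicator_of_notMem (a := y), mul_zero, zero_mul]
    simpa using hy

lemma aux_conv (a b c t : ℝ) (ha : 0 < a) (hb : 0 < b) (ht : 0 < t) :
    lconvolution (SK (-c) (EK b)) (EK a) volume t =
    ENNReal.ofReal (2 ^ (1 - (a + b)) / Real.Gamma (a + b) *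
      (1 - Real.exp (-(2 * t))) ^ (a + b - 1) *
      gaussHyp (a - c / 2) b (b + a) (1 - Real.exp (-(2 * t)))) := by
  have h := aux_conv_lint a b c t _ ha hb ht rfl
  have hga := Real.Gamma_pos_of_pos ha
  have hgb := Real.Gamma_pos_of_pos hb
  have hgab := Real.Gamma_pos_of_pos (add_pos ha hb)
  have : lconvolution (SK (-c) (EK b)) (EK a) volume t =
      ENNReal.ofReal (2 ^ (1 - a) / Real.Gamma a * (2 ^ (1 - b) / Real.Gamma b)) *
      ∫⁻ s in Ioo 0 t, ENNReal.ofReal (Real.exp (-c * s) * (1 - Real.exp (-(2 * s))) ^ (b - 1) *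
      (1 - Real.exp (-(2 * (t - s)))) ^ (a - 1)) := by
    rw [lconvolution_def, ← lintegral_const_mul' _ _ ENNReal.ofReal_ne_top,
      ← lintegral_indicator measurableSet_Ioo]
    refine lintegral_congr fun y => ?_
    simp only [SK, EK]
    by_cases hy : y ∈ Ioo 0 t
    · have hy2 : -y + t ∈ Ioi (0:ℝ) := by simp only [mem_Ioi]; linarith [hy.2]
      rw [indicator_of_mem hy, indicator_of_mem (show y ∈ Ioi (0:ℝ) from hy.1), indicator_of_mem hy2]
      have h1 : 0 < 1 - Real.exp (-(2 * y)) := by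
        have := Real.exp_lt_one_iff.2 (show -(2*y) < 0 by linarith [hy.1]); linarith
      have h2 : 0 < 1 - Real.exp (-(2 * (t - y))) := by
        have := Real.exp_lt_one_iff.2 (show -(2*(t-y)) < 0 by linarith [hy.2]); linarith
      rw [show -y + t = t - y by ring]
      rw [← ENNReal.ofReal_mul (by positivity), ← ENNReal.ofReal_mul (by positivity),
        ← ENNReal.ofReal_mul (by positivity)]
      congr 1; ring
    · rw [indicator_of_notMem hy]
      by_cases hy1 : 0 < y
      · rw [indicator_of_notMem (a := -y + t), mul_zero]
        simp only [mem_Ioi]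
        intro h3; exact hy ⟨hy1, by linarith⟩
      · rw [indicator_of_notMem (a := y), mul_zero, zero_mul]
        simpa using hy1
  rw [this, h, ← ENNReal.ofReal_mul (by positivity)]
  congr 1
  rw [ProbabilityTheory.beta, show (2:ℝ) ^ (1 - (a+b)) = 2 ^ (1-a) * 2 ^ (1 - b) / 2 by
    rw [← Real.rpow_add (by norm_num), ← Real.rpow_sub_one (by norm_num)]; ring_nf, add_comm b a]
  field_simp

lemma gaussHyp_zero (b c z : ℝ) : gaussHyp 0 b c z = 1 := by
  rw [gaussHyp, tsum_eq_single 0]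
  · simp
  · intro n hn
    obtain ⟨m, rfl⟩ := Nat.exists_eq_succ_of_ne_zero hn
    rw [ascPochhammer_ne_zero_eval_zero _ (by simp)]; simp

lemma EK_conv (a b : ℝ) (ha : 0 < a) (hb : 0 < b) :
    lconvolution (EK a) (SK (-(2 * a)) (EK b)) volume = EK (a + b) := by
  rw [lconvolution_comm]
  ext t
  rcases le_or_gt t 0 with ht | ht
  · rw [aux_conv_of_nonpos _ _ _ _ ht, EK, indicator_of_notMem]
    simpa using ht
  · rw [aux_conv a b (2*a) t ha hb ht, EK, indicator_of_mem (show t ∈ Ioi 0 from ht),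
      show a - 2 * a / 2 = 0 by ring, gaussHyp_zero, mul_one]

lemma MK_conv (ν a b : ℝ) (ha : 0 < a) (hb : 0 < b) :
    lconvolution (MK ν a) (SK (-(2 * a)) (MK ν b)) volume = MK ν (a + b) := by
  unfold MK
  rw [SK_conv _ _ _ (by fun_prop) (by fun_prop), SK_SK, add_comm (-(2*a)), ← SK_SK,
    ← lconvolution_assoc (by fun_prop) (by fun_prop) (measurable_lconvolution _ (by fun_prop) (by fun_prop)),
    lconvolution_assoc (f := EK a) (by fun_prop) (by fun_prop) (by fun_prop),
    lconvolution_comm (f := EK a), 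
    ← lconvolution_assoc (k := SK _ _) (by fun_prop) (by fun_prop) (by fun_prop),
    EK_conv a b ha hb,
    lconvolution_assoc (by fun_prop) (by fun_prop) (by fun_prop),
    ← SK_conv _ _ _ (by fun_prop) (by fun_prop), EK_conv a b ha hb]

noncomputable def mk (ν a t : ℝ) : ℝ := (MK ν a t).toReal

lemma MK_of_nonpos (ν a t : ℝ) (ht : t ≤ 0) : MK ν a t = 0 := aux_conv_of_nonpos _ _ _ _ ht

lemma MK_of_pos (ν a t : ℝ) (ha : 0 < a) (ht : 0 < t) : MK ν a t =
    ENNReal.ofReal (2 ^ (1 - 2 * a) / Real.Gamma (2 * a) *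
      (1 - Real.exp (-(2 * t))) ^ (2 * a - 1) *
      gaussHyp (a + (ν - 1) / 2) a (2 * a) (1 - Real.exp (-(2 * t)))) := by
  have := aux_conv a a (-(ν - 1)) t ha ha ht
  rw [neg_neg] at this
  rw [MK, this]
  rw [← two_mul, show a - -(ν - 1) / 2 = a + (ν - 1) / 2 by ring]

lemma MK_ne_top (ν a t : ℝ) (ha : 0 < a) : MK ν a t ≠ ⊤ := by
  rcases le_or_gt t 0 with ht | ht
  · simp [MK_of_nonpos ν a t ht]
  · rw [MK_of_pos ν a t ha ht]; exact ENNReal.ofReal_ne_top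

lemma mk_nonneg (ν a t : ℝ) : 0 ≤ mk ν a t := ENNReal.toReal_nonneg

@[fun_prop]
lemma measurable_mk (ν a : ℝ) : Measurable (mk ν a) := by
  unfold mk; fun_prop

lemma mk_of_nonpos (ν a t : ℝ) (ht : t ≤ 0) : mk ν a t = 0 := by
  simp [mk, MK_of_nonpos ν a t ht]

lemma aux_z (t : ℝ) (ht : 0 < t) : 0 < 1 - Real.exp (-(2 * t)) ∧ 1 - Real.exp (-(2 * t)) < 1 := by
  have := Real.exp_lt_one_iff.2 (show -(2*t) < 0 by linarith)
  have := Real.exp_pos (-(2*t))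
  constructor <;> linarith

lemma gaussHyp_nonneg (a b d z : ℝ) (hb : 0 < b) (hd : 0 < d) (hz0 : 0 ≤ z) (hz1 : z < 1) :
    0 ≤ gaussHyp a b (b + d) z := by
  have h := (aux_euler a b d z hb hd hz0 hz1).2
  have h2 : 0 ≤ ∫ x in Ioo (0:ℝ) 1, x ^ (b - 1) * (1 - x) ^ (d - 1) * (1 - z * x) ^ (-a) := by
    refine setIntegral_nonneg measurableSet_Ioo fun x hx => ?_
    have := hx.1
    have : 0 < 1 - x := by linarith [hx.2]
    have : 0 < 1 - z * x := by nlinarith [hx.1, hx.2]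
    positivity
  rw [h] at h2
  exact nonneg_of_mul_nonneg_right h2 (ProbabilityTheory.beta_pos hb hd)

lemma mk_of_pos (ν a t : ℝ) (ha : 0 < a) (ht : 0 < t) : mk ν a t =
    2 ^ (1 - 2 * a) / Real.Gamma (2 * a) *
      (1 - Real.exp (-(2 * t))) ^ (2 * a - 1) *
      gaussHyp (a + (ν - 1) / 2) a (2 * a) (1 - Real.exp (-(2 * t))) := by
  rw [mk, MK_of_pos ν a t ha ht, ENNReal.toReal_ofReal]
  obtain ⟨h1, h2⟩ := aux_z t ht
  have h3 := gaussHyp_nonneg (a + (ν - 1) / 2) a a _ ha ha h1.le h2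
  rw [← two_mul] at h3
  have := Real.Gamma_pos_of_pos (show 0 < 2 * a by linarith)
  positivity

lemma IB_eq (ν a t : ℝ) (ha : 0 < a) (f : ℝ → ℝ) : IB ν a f (Real.exp (-t)) =
    ∫ s, mk ν a (t - s) * (Real.exp (-(2 * a * s)) * f (Real.exp (-s))) := by
  have himg : Ioi (Real.exp (-t)) = (fun s => Real.exp (-s)) '' Iio t := by
    ext y
    constructor
    · intro hy
      have hy0 : 0 < y := (Real.exp_pos _).trans hy
      refine ⟨-Real.log y, ?_, by simp [Real.exp_log hy0]⟩
      have := (Real.lt_log_iff_exp_lt hy0).2 hy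
      simp only [mem_Iio]; linarith
    · rintro ⟨s, hs, rfl⟩
      simp only [mem_Iio] at hs
      simp only [mem_Ioi, Real.exp_lt_exp]; linarith
  rw [IB, himg, integral_image_eq_integral_abs_deriv_smul (f' := fun s => -Real.exp (-s)) measurableSet_Iio]
  · rw [← integral_const_mul]
    symm
    rw [← setIntegral_eq_integral_of_forall_compl_eq_zero (s := Iio t)]
    · refine setIntegral_congr_fun measurableSet_Iio fun s hs => ?_
      simp only [mem_Iio] at hs
      have hts : 0 < t - s := by linarith
      obtain ⟨h1, h2⟩ := aux_z (t - s) hts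
      beta_reduce
      rw [mk_of_pos ν a _ ha hts, abs_neg, abs_of_pos (Real.exp_pos _), smul_eq_mul]
      have e1 : Real.exp (-t) ^ 2 / Real.exp (-s) ^ 2 = Real.exp (-(2 * (t - s))) := by
        rw [← Real.exp_nat_mul, ← Real.exp_nat_mul, ← Real.exp_sub]; push_cast; ring_nf
      have e2 : (Real.exp (-s) ^ 2 - Real.exp (-t) ^ 2) / (2 * Real.exp (-s)) =
          Real.exp (-s) * (1 - Real.exp (-(2 * (t - s)))) * 2⁻¹ := by
        rw [← e1]; field_simp
      rw [e2, e1, Real.mul_rpow (by positivity) (by positivity), Real.mul_rpow (by positivity) h1.le,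
        ← Real.exp_mul]
      have e3 : Real.exp (-(2 * a * s)) = Real.exp (-s) * Real.exp (-s * (2 * a - 1)) := by
        rw [← Real.exp_add]; ring_nf
      have e4 : (2⁻¹ : ℝ) ^ (2 * a - 1) = 2 ^ (1 - 2 * a) := by
        rw [Real.inv_rpow (by norm_num), ← Real.rpow_neg (by norm_num)]; ring_nf
      rw [e3, e4]; ring
    · intro s hs
      simp only [mem_Iio, not_lt] at hs
      rw [mk_of_nonpos _ _ _ (by linarith), zero_mul]
  · intro s _
    have := (hasDerivAt_neg s).exp
    exact (this.congr_deriv (by simp)).hasDerivWithinAt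
  · intro s _ s' _ h
    simpa using h

lemma aux_lint_conv (f g : ℝ → ℝ≥0∞) (hf : Measurable f) (hg : Measurable g) :
    ∫⁻ t, lconvolution f g volume t = (∫⁻ t, f t) * ∫⁻ t, g t := by
  simp only [lconvolution_def]
  rw [lintegral_lintegral_swap (by fun_prop), ← lintegral_mul_const _ hf]
  refine lintegral_congr fun y => ?_
  rw [lintegral_const_mul _ (by fun_prop), lintegral_add_left_eq_self g (-y)]

lemma aux_EK_exp (a p : ℝ) (ha : 0 < a) (hp : 0 < p) : ∫⁻ t, SK (-p) (EK a) t ≠ ⊤ := by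
  have hga := Real.Gamma_pos_of_pos ha
  have himg : (fun s => Real.exp (-(2 * s))) '' Ioi 0 = Ioo 0 1 := by
    ext y
    constructor
    · rintro ⟨s, hs, rfl⟩
      simp only [mem_Ioi] at hs
      exact ⟨Real.exp_pos _, Real.exp_lt_one_iff.2 (by linarith)⟩
    · rintro ⟨h0, h1⟩
      refine ⟨-Real.log y / 2, ?_, ?_⟩
      · have := Real.log_neg h0 h1
        simp only [mem_Ioi]; linarith
      · show Real.exp _ = _
        rw [show -(2 * (-Real.log y / 2)) = Real.log y by ring, Real.exp_log h0]
  have h := aux_beta_l (p / 2) a (by positivity) ha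
  rw [← himg, lintegral_image_eq_lintegral_abs_deriv_mul (f' := fun s => -(2 * Real.exp (-(2 * s))))
      measurableSet_Ioi] at h
  · have : ∫⁻ t, SK (-p) (EK a) t = ENNReal.ofReal (2 ^ (1 - a) / Real.Gamma a / 2) *
        ENNReal.ofReal (ProbabilityTheory.beta (p/2) a) := by
      rw [← h, ← lintegral_const_mul' _ _ ENNReal.ofReal_ne_top, ← lintegral_indicator measurableSet_Ioi]
      refine lintegral_congr fun t => ?_
      simp only [SK, EK]
      by_cases ht : t ∈ Ioi (0:ℝ)
      · rw [indicator_of_mem ht, indicator_of_mem ht]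
        obtain ⟨h1, h2⟩ := aux_z t ht
        rw [abs_neg, abs_of_pos (by positivity), ← ENNReal.ofReal_mul (by positivity),
          ← ENNReal.ofReal_mul (by positivity), ← ENNReal.ofReal_mul (by positivity)]
        congr 1
        rw [← Real.exp_mul]
        have : Real.exp (-p * t) = Real.exp (-(2 * t)) * Real.exp (-(2 * t) * (p / 2 - 1)) := by
          rw [← Real.exp_add]; ring_nf
        rw [this]; field_simp
      · rw [indicator_of_notMem ht, indicator_of_notMem ht, mul_zero]
    rw [this]
    exact ENNReal.mul_ne_top ENNReal.ofReal_ne_top ENNReal.ofReal_ne_top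
  · intro s _
    have := ((hasDerivAt_id s).const_mul 2).neg.exp
    exact (this.congr_deriv (by simp only [id, Pi.neg_apply]; ring)).hasDerivWithinAt
  · intro s _ s' _ h
    simpa using h

lemma mk_exp_int (ν a p : ℝ) (ha : 0 < a) (hp : 0 < p) (hp' : ν - 1 < p) :
    Integrable fun t => mk ν a t * Real.exp (-(p * t)) := by
  have h : ∫⁻ t, SK (-p) (MK ν a) t ≠ ⊤ := by
    rw [MK, SK_conv _ _ _ (by fun_prop) (by fun_prop), SK_SK, aux_lint_conv _ _ (by fun_prop) (by fun_prop)]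
    refine ENNReal.mul_ne_top ?_ (aux_EK_exp a p ha hp)
    have := aux_EK_exp a (p - (ν - 1)) ha (by linarith)
    rwa [show -(p - (ν-1)) = -p + (ν - 1) by ring] at this
  have h2 := integrable_toReal_of_lintegral_ne_top (by fun_prop) h
  refine h2.congr (Filter.Eventually.of_forall fun t => ?_)
  simp only [SK, mk, ENNReal.toReal_mul]
  rw [ENNReal.toReal_ofReal (by positivity), mul_comm]; simp

lemma mk_conv (ν a b t : ℝ) (ha : 0 < a) (hb : 0 < b) :
    (Integrable fun s => mk ν a (t - s) * (Real.exp (-(2 * a * s)) * mk ν b s)) ∧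
    ∫ s, mk ν a (t - s) * (Real.exp (-(2 * a * s)) * mk ν b s) = mk ν (a + b) t := by
  have h : ∫⁻ s, SK (-(2 * a)) (MK ν b) s * MK ν a (-s + t) = MK ν (a + b) t := by
    rw [← MK_conv ν a b ha hb, lconvolution_comm, lconvolution_def]
  have hm : AEMeasurable (fun s => SK (-(2 * a)) (MK ν b) s * MK ν a (-s + t)) volume := by fun_prop
  have e : (fun s => mk ν a (t - s) * (Real.exp (-(2 * a * s)) * mk ν b s)) =
      fun s => (SK (-(2 * a)) (MK ν b) s * MK ν a (-s + t)).toReal := by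
    ext s
    simp only [SK, mk, ENNReal.toReal_mul]
    rw [ENNReal.toReal_ofReal (by positivity), show -s + t = t - s by ring]; ring_nf
  rw [e]
  have hne : MK ν (a + b) t ≠ ⊤ := MK_ne_top _ _ _ (by positivity)
  constructor
  · exact integrable_toReal_of_lintegral_ne_top hm (by rwa [h])
  · rw [integral_toReal hm (ae_lt_top' hm (by rwa [h])), h, mk]

lemma mk_conv' (ν a b t r : ℝ) (ha : 0 < a) (hb : 0 < b) :
    (Integrable fun s => mk ν a (t - s) * (Real.exp (-(2 * a * s)) * mk ν b (s - r))) ∧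
    ∫ s, mk ν a (t - s) * (Real.exp (-(2 * a * s)) * mk ν b (s - r)) =
      Real.exp (-(2 * a * r)) * mk ν (a + b) (t - r) := by
  obtain ⟨h1, h2⟩ := mk_conv ν a b (t - r) ha hb
  have e : (fun s => mk ν a (t - s) * (Real.exp (-(2 * a * s)) * mk ν b (s - r))) =
      fun s => (fun s => Real.exp (-(2 * a * r)) *
        (mk ν a (t - r - s) * (Real.exp (-(2 * a * s)) * mk ν b s))) (s - r) := by
    ext s
    have : Real.exp (-(2 * a * s)) = Real.exp (-(2 * a * r)) * Real.exp (-(2 * a * (s - r))) := by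
      rw [← Real.exp_add]; ring_nf
    beta_reduce
    rw [this, show t - r - (s - r) = t - s by ring]; ring
  rw [e]
  constructor
  · exact (h1.const_mul _).comp_sub_right r
  · rw [integral_sub_right_eq_self (fun s => Real.exp (-(2 * a * r)) *
        (mk ν a (t - r - s) * (Real.exp (-(2 * a * s)) * mk ν b s))) r, integral_const_mul, h2]

lemma mk_int (ν a p C t : ℝ) (ψ : ℝ → ℝ) (ha : 0 < a) (hp : 0 < p) (hp' : ν - 1 < p)
    (hψ : AEStronglyMeasurable ψ) (hb : ∀ s, |ψ s| ≤ C * Real.exp (p * s)) :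
    Integrable fun s => mk ν a (t - s) * ψ s := by
  have h := ((mk_exp_int ν a p ha hp hp').comp_sub_left t).mul_const (C * Real.exp (p * t))
  refine h.mono' ?_ (Filter.Eventually.of_forall fun s => ?_)
  · exact (Measurable.aestronglyMeasurable (by fun_prop)).mul hψ
  · rw [norm_mul, Real.norm_of_nonneg (mk_nonneg _ _ _), Real.norm_eq_abs, mul_assoc]
    refine mul_le_mul_of_nonneg_left ((hb s).trans (le_of_eq ?_)) (mk_nonneg _ _ _)
    have : Real.exp (p * s) = Real.exp (-(p * (t - s))) * Real.exp (p * t) := by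
      rw [← Real.exp_add]; ring_nf
    rw [this]; ring

lemma aux_bound (g : ℝ → ℝ) (hg : Continuous g) (hs : HasCompactSupport g) (q : ℝ) (hq : 0 ≤ q) :
    ∃ C, ∀ s, |g (Real.exp (-s))| ≤ C * Real.exp (q * s) := by
  obtain ⟨C, hC⟩ := hs.exists_bound_of_continuous hg
  obtain ⟨R, hR0, hR⟩ := hs.isCompact.isBounded.subset_closedBall_lt 0 0
  refine ⟨C * Real.exp (q * Real.log R), fun s => ?_⟩
  have hC0 : 0 ≤ C := (norm_nonneg _).trans (hC 0)
  by_cases h : Real.exp (-s) ∈ tsupport g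
  · have h1 := hR h
    simp only [Metric.mem_closedBall, dist_zero_right, Real.norm_eq_abs, Real.abs_exp] at h1
    have h2 : -s ≤ Real.log R := (Real.le_log_iff_exp_le hR0).2 h1
    rw [mul_assoc, ← Real.exp_add]
    have h3 : 1 ≤ Real.exp (q * Real.log R + q * s) := by
      rw [Real.one_le_exp_iff]; nlinarith
    calc |g (Real.exp (-s))| ≤ C := hC _
      _ ≤ _ := le_mul_of_one_le_right hC0 h3
  · rw [image_eq_zero_of_notMem_tsupport h, abs_zero]
    positivity

lemma aux_bound2 (g : ℝ → ℝ) (hg : Continuous g) (hs : HasCompactSupport g) (b p : ℝ) (hb : 0 < b)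
    (hp : 0 < p) :
    ∃ C, ∀ s, |Real.exp (-(2 * b * s)) * g (Real.exp (-s))| ≤ C * Real.exp (p * s) := by
  obtain ⟨C, hC⟩ := aux_bound g hg hs (p + 2 * b) (by positivity)
  refine ⟨C, fun s => ?_⟩
  rw [abs_mul, Real.abs_exp]
  have : Real.exp (p * s) = Real.exp (-(2 * b * s)) * Real.exp ((p + 2 * b) * s) := by
    rw [← Real.exp_add]; ring_nf
  rw [this]
  nlinarith [mul_le_mul_of_nonneg_left (hC s) (Real.exp_pos (-(2 * b * s))).le]

lemma IB_semigroup (ν a b : ℝ) (ha : 0 < a) (hb : 0 < b) (g : ℝ → ℝ) (hg : Continuous g)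
    (hs : HasCompactSupport g) (t : ℝ) :
    IB ν a (IB ν b g) (Real.exp (-t)) = IB ν (a + b) g (Real.exp (-t)) := by
  rw [IB_eq ν a t ha, IB_eq ν (a + b) t (by positivity)]
  simp_rw [IB_eq ν b _ hb]
  set F : ℝ → ℝ → ℝ := fun s r => mk ν a (t - s) * (Real.exp (-(2 * a * s)) * mk ν b (s - r)) *
    (Real.exp (-(2 * b * r)) * g (Real.exp (-r))) with hF
  have hFm : Measurable (Function.uncurry F) := by
    have := hg.measurable
    unfold Function.uncurry
    simp only [hF]
    fun_prop
  set p := max 1 ν with hp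
  have hp0 : 0 < p := lt_of_lt_of_le one_pos (le_max_left _ _)
  have hp1 : ν - 1 < p := by have := le_max_right 1 ν; linarith
  have hFi : Integrable (Function.uncurry F) (volume.prod volume) := by
    rw [integrable_prod_iff' hFm.aestronglyMeasurable]
    constructor
    · refine Filter.Eventually.of_forall fun r => ?_
      exact (mk_conv' ν a b t r ha hb).1.mul_const (Real.exp (-(2 * b * r)) * g (Real.exp (-r)))
    · obtain ⟨C, hC⟩ := aux_bound2 g hg hs (a + b) p (by positivity) hp0
      have := (mk_int ν (a + b) p C t _ (by positivity) hp0 hp1 (Measurable.aestronglyMeasurable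
        (by have := hg.measurable; fun_prop)) hC).norm
      refine this.congr (Filter.Eventually.of_forall fun r => ?_)
      simp only [Function.uncurry, hF, norm_mul, Real.norm_of_nonneg (mk_nonneg _ _ _),
        Real.norm_of_nonneg (Real.exp_pos _).le]
      rw [integral_mul_const, (mk_conv' ν a b t r ha hb).2]
      have : Real.exp (-(2 * (a + b) * r)) = Real.exp (-(2 * a * r)) * Real.exp (-(2 * b * r)) := by
        rw [← Real.exp_add]; ring_nf
      rw [this]; ring
  have e1 : ∀ s, mk ν a (t - s) * (Real.exp (-(2 * a * s)) *
      ∫ r, mk ν b (s - r) * (Real.exp (-(2 * b * r)) * g (Real.exp (-r)))) = ∫ r, F s r := by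
    intro s
    rw [← mul_assoc, ← integral_const_mul]
    congr 1; ext r; simp only [hF]; ring
  simp_rw [e1]
  rw [integral_integral_swap hFi]
  congr 1; ext r
  simp only [hF]
  rw [integral_mul_const, (mk_conv' ν a b t r ha hb).2]
  have : Real.exp (-(2 * (a + b) * r)) = Real.exp (-(2 * a * r)) * Real.exp (-(2 * b * r)) := by
    rw [← Real.exp_add]; ring_nf
  rw [this]; ring

lemma IB_continuousOn (ν a : ℝ) (ha : 0 < a) (g : ℝ → ℝ) (hg : Continuous g)
    (hs : HasCompactSupport g) : ContinuousOn (IB ν a g) (Ioi 0) := by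
  set p := max 1 ν with hp
  have hp0 : 0 < p := lt_of_lt_of_le one_pos (le_max_left _ _)
  have hp1 : ν - 1 < p := by have := le_max_right 1 ν; linarith
  obtain ⟨C, hC⟩ := aux_bound2 g hg hs a p (by positivity) hp0
  set ψ : ℝ → ℝ := fun s => Real.exp (-(2 * a * s)) * g (Real.exp (-s)) with hψ
  have hψc : Continuous ψ := by fun_prop
  have hcont : Continuous fun t => ∫ s, mk ν a s * Real.exp (-(p * s)) *
      (Real.exp (-(p * (t - s))) * ψ (t - s)) := by
    refine continuous_of_dominated (bound := fun s => mk ν a s * Real.exp (-(p * s)) * C) ?_ ?_ ?_ ?_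
    · intro t
      have := hψc.measurable
      exact Measurable.aestronglyMeasurable (by fun_prop)
    · intro t
      refine Filter.Eventually.of_forall fun s => ?_
      rw [norm_mul, Real.norm_of_nonneg (mul_nonneg (mk_nonneg _ _ _) (Real.exp_pos _).le)]
      refine mul_le_mul_of_nonneg_left ?_ (mul_nonneg (mk_nonneg _ _ _) (Real.exp_pos _).le)
      rw [norm_mul, Real.norm_of_nonneg (Real.exp_pos _).le, Real.norm_eq_abs]
      calc _ ≤ Real.exp (-(p * (t - s))) * (C * Real.exp (p * (t - s))) :=
            mul_le_mul_of_nonneg_left (hC _) (Real.exp_pos _).le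
        _ = C := by rw [mul_left_comm, ← Real.exp_add]; simp
    · exact (mk_exp_int ν a p ha hp0 hp1).mul_const _
    · exact Filter.Eventually.of_forall fun s => by fun_prop
  have hform : ∀ x ∈ Ioi (0:ℝ), IB ν a g x = Real.exp (p * (-Real.log x)) *
      (fun t => ∫ s, mk ν a s * Real.exp (-(p * s)) *
      (Real.exp (-(p * (t - s))) * ψ (t - s))) (-Real.log x) := by
    intro x hx
    conv_lhs => rw [← Real.exp_log hx, ← neg_neg (Real.log x)]
    rw [IB_eq ν a _ ha, ← integral_sub_left_eq_self _ volume (-Real.log x)]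
    beta_reduce
    rw [← integral_const_mul]
    congr 1; ext s
    have : (1:ℝ) = Real.exp (p * (-Real.log x)) * Real.exp (-(p * s)) *
      Real.exp (-(p * (-Real.log x - s))) := by
      rw [← Real.exp_add, ← Real.exp_add]; symm; rw [Real.exp_eq_one_iff]; ring
    rw [sub_sub_cancel]
    calc _ = 1 * (mk ν a s * ψ (-Real.log x - s)) := by rw [one_mul]
      _ = _ := by rw [this]; ring
  refine ContinuousOn.congr ?_ hform
  have hl : ContinuousOn (fun x : ℝ => -Real.log x) (Ioi 0) :=
    (Real.continuousOn_log.mono (fun x hx => (ne_of_gt hx))).neg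
  exact ((Real.continuous_exp.comp (continuous_const.mul continuous_id)).comp_continuousOn hl).mul
    (hcont.comp_continuousOn hl)

lemma kernel_one (ν x y : ℝ) (hx : 0 < x) (hxy : x < y) :
    ((y ^ 2 - x ^ 2) / (2 * y)) ^ (2 * (1:ℝ) - 1) *
      gaussHyp (1 + (ν - 1) / 2) 1 (2 * 1) (1 - x ^ 2 / y ^ 2) =
    y ^ ν * ∫ r in x..y, r ^ (-ν) := by
  have hy : 0 < y := hx.trans hxy
  have hd : 0 < y ^ 2 - x ^ 2 := by nlinarith
  have hz0 : 0 ≤ 1 - x ^ 2 / y ^ 2 := by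
    rw [sub_nonneg, div_le_one (by positivity)]; linarith
  have hz1 : 1 - x ^ 2 / y ^ 2 < 1 := by
    have : 0 < x ^ 2 / y ^ 2 := by positivity
    linarith
  have h := (aux_euler (1 + (ν - 1) / 2) 1 1 _ one_pos one_pos hz0 hz1).2
  have hb : ProbabilityTheory.beta 1 1 = 1 := by
    rw [← aux_beta 1 1 one_pos one_pos]; simp
  have himg : (fun r => (y ^ 2 - r ^ 2) / (y ^ 2 - x ^ 2)) '' Ioo x y = Ioo 0 1 := by
    ext τ
    constructor
    · rintro ⟨r, hr, rfl⟩
      have hr0 : 0 < r := hx.trans hr.1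
      constructor
      · exact div_pos (by nlinarith [hr.2]) hd
      · show _ / _ < _
        rw [div_lt_one hd]; nlinarith [hr.1]
    · rintro ⟨h0, h1⟩
      have hp : x ^ 2 < y ^ 2 - τ * (y ^ 2 - x ^ 2) := by nlinarith
      refine ⟨Real.sqrt (y ^ 2 - τ * (y ^ 2 - x ^ 2)), ⟨?_, ?_⟩, ?_⟩
      · exact Real.lt_sqrt_of_sq_lt hp
      · rw [Real.sqrt_lt' hy]; nlinarith
      · show (_ - _ ^ 2) / _ = _
        rw [Real.sq_sqrt (by nlinarith [sq_nonneg x])]; field_simp; ring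
  rw [hb, one_mul, ← himg, integral_image_eq_integral_abs_deriv_smul
    (f' := fun r => -(2 * r) / (y ^ 2 - x ^ 2)) measurableSet_Ioo] at h
  · rw [show (2:ℝ) * 1 = 1 + 1 by norm_num, ← h, show (1:ℝ) + 1 - 1 = 1 by norm_num, Real.rpow_one,
      intervalIntegral.integral_of_le hxy.le, integral_Ioc_eq_integral_Ioo,
      ← integral_const_mul, ← integral_const_mul]
    refine setIntegral_congr_fun measurableSet_Ioo fun r hr => ?_
    have hr0 : 0 < r := hx.trans hr.1
    beta_reduce
    rw [smul_eq_mul, neg_div, abs_neg, abs_of_pos (by positivity), sub_self, Real.rpow_zero,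
      Real.rpow_zero, one_mul, one_mul]
    have e : 1 - (1 - x ^ 2 / y ^ 2) * ((y ^ 2 - r ^ 2) / (y ^ 2 - x ^ 2)) = (r / y) ^ (2:ℝ) := by
      rw [show (2:ℝ) = ((2:ℕ):ℝ) by norm_num, Real.rpow_natCast]
      field_simp; ring
    rw [e, ← Real.rpow_mul (by positivity), show 2 * -(1 + (ν - 1) / 2) = -ν - 1 by ring,
      Real.rpow_sub_one (by positivity), Real.div_rpow hr0.le hy.le, Real.rpow_neg hy.le]
    have := (Real.rpow_pos_of_pos hy ν).ne'
    field_simp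
  · intro r _
    have := (((hasDerivAt_id r).pow 2).const_sub (y ^ 2)).div_const (y ^ 2 - x ^ 2)
    exact (this.congr_deriv (by simp)).hasDerivWithinAt
  · intro r hr r' hr' hh
    beta_reduce at hh
    rw [div_left_inj' hd.ne', sub_right_inj] at hh
    exact (sq_eq_sq₀ (hx.trans hr.1).le (hx.trans hr'.1).le).1 hh

lemma aux_ii (f : ℝ → ℝ) (hf : ContinuousOn f (Ioi 0)) (a b : ℝ) (ha : 0 < a) (hb : 0 < b) :
    IntervalIntegrable f volume a b :=
  (hf.mono fun x hx => lt_of_lt_of_le (lt_min ha hb) hx.1).intervalIntegrable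

lemma aux_ftc (f : ℝ → ℝ) (hf : ContinuousOn f (Ioi 0)) (a x : ℝ) (ha : 0 < a) (hx : 0 < x) :
    HasDerivAt (fun u => ∫ y in a..u, f y) (f x) x :=
  intervalIntegral.integral_hasDerivAt_right (aux_ii f hf a x ha hx)
    (hf.stronglyMeasurableAtFilter isOpen_Ioi x hx) (hf.continuousAt (Ioi_mem_nhds hx))

lemma aux_rpow_cont (ν : ℝ) : ContinuousOn (fun y : ℝ => y ^ ν) (Ioi 0) :=
  fun x hx => (Real.continuousAt_rpow_const x ν (Or.inl (ne_of_gt hx))).continuousWithinAt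

lemma IB_one (ν x R : ℝ) (hx : 0 < x) (hxR : x < R) (h : ℝ → ℝ) (hh : ContinuousOn h (Ioi 0))
    (h0 : ∀ y, R ≤ y → h y = 0) :
    IB ν 1 h x = ∫ y in R..x, y ^ (-ν) * ∫ s in R..y, s ^ ν * h s := by
  have hR : 0 < R := hx.trans hxR
  have hph : ContinuousOn (fun s => s ^ ν * h s) (Ioi 0) := (aux_rpow_cont ν).mul hh
  set P : ℝ → ℝ := fun y => ∫ s in R..y, s ^ ν * h s with hP
  set Q : ℝ → ℝ := fun y => ∫ s in x..y, s ^ (-ν) with hQ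
  have hPd : ∀ y, 0 < y → HasDerivAt P (y ^ ν * h y) y := fun y hy => aux_ftc _ hph R y hR hy
  have hQd : ∀ y, 0 < y → HasDerivAt Q (y ^ (-ν)) y :=
    fun y hy => aux_ftc _ (aux_rpow_cont (-ν)) x y hx hy
  have hpos : ∀ y ∈ uIcc x R, 0 < y := fun y hy => lt_of_lt_of_le (lt_min hx hR) hy.1
  have ibp := intervalIntegral.integral_mul_deriv_eq_deriv_mul (a := x) (b := R) (u := Q) (v := P)
    (fun y hy => hQd y (hpos y hy)) (fun y hy => hPd y (hpos y hy))
    (aux_ii _ (aux_rpow_cont _) _ _ hx hR) (aux_ii _ hph _ _ hx hR)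
  have hQx : Q x = 0 := by simp [hQ]
  have hPR : P R = 0 := by simp [hP]
  rw [hQx, hPR, mul_zero, zero_mul, sub_zero, zero_sub, ← intervalIntegral.integral_symm] at ibp
  rw [← ibp, IB, mul_one, Real.Gamma_two, one_div_one, one_mul, intervalIntegral.integral_of_le hxR.le]
  rw [setIntegral_eq_of_subset_of_forall_sdiff_eq_zero (s := Ioc x R) measurableSet_Ioi Ioc_subset_Ioi_self]
  · refine setIntegral_congr_fun measurableSet_Ioc fun y hy => ?_
    have := kernel_one ν x y hx hy.1
    rw [mul_one] at this
    beta_reduce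
    rw [this]; simp only [hQ]; ring
  · intro y hy
    have : R ≤ y := by
      by_contra hc
      exact hy.2 ⟨hy.1, (not_le.1 hc).le⟩
    rw [h0 y this, mul_zero]

lemma bessel_IB_one (ν R : ℝ) (h : ℝ → ℝ) (hh : ContinuousOn h (Ioi 0))
    (h0 : ∀ y, R ≤ y → h y = 0) (x : ℝ) (hx : 0 < x) : besselOp ν (IB ν 1 h) x = h x := by
  set S := max R (x + 1) with hS
  have hxS : x < S := lt_of_lt_of_le (by linarith) (le_max_right _ _)
  have hS0 : 0 < S := hx.trans hxS
  have hph : ContinuousOn (fun s => s ^ ν * h s) (Ioi 0) := (aux_rpow_cont ν).mul hh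
  set P : ℝ → ℝ := fun y => ∫ s in S..y, s ^ ν * h s with hP
  have hPd : ∀ y, 0 < y → HasDerivAt P (y ^ ν * h y) y := fun y hy => aux_ftc _ hph S y hS0 hy
  have hPc : ContinuousOn (fun y => y ^ (-ν) * P y) (Ioi 0) :=
    (aux_rpow_cont _).mul fun y hy => (hPd y hy).continuousAt.continuousWithinAt
  have hU : ∀ y ∈ Ioo 0 S, IB ν 1 h y = ∫ r in S..y, r ^ (-ν) * P r := fun y hy =>
    IB_one ν y S hy.1 hy.2 h hh fun w hw => h0 w ((le_max_left _ _).trans hw)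
  have hd : ∀ y ∈ Ioo 0 S, HasDerivAt (IB ν 1 h) (y ^ (-ν) * P y) y := by
    intro y hy
    refine (aux_ftc _ hPc S y hS0 hy.1).congr_of_eventuallyEq ?_
    filter_upwards [Ioo_mem_nhds hy.1 hy.2] with w hw using hU w hw
  have hd2 : HasDerivAt (deriv (IB ν 1 h))
      (-ν * x ^ (-ν - 1) * P x + x ^ (-ν) * (x ^ ν * h x)) x := by
    have h1 := (Real.hasDerivAt_rpow_const (x := x) (p := -ν) (Or.inl hx.ne')).mul (hPd x hx)
    refine h1.congr_of_eventuallyEq ?_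
    filter_upwards [Ioo_mem_nhds hx hxS] with w hw using (hd w hw).deriv
  rw [besselOp, hd2.deriv, (hd x ⟨hx, hxS⟩).deriv, Real.rpow_sub_one hx.ne', Real.rpow_neg hx.le]
  have := (Real.rpow_pos_of_pos hx ν).ne'
  field_simp
  ring

def Cc (f : ℝ → ℝ) : Prop :=
  ContDiff ℝ (⊤ : ℕ∞) f ∧ HasCompactSupport f ∧ tsupport f ⊆ Ioi (0 : ℝ)

lemma bessel_zero_off (ν : ℝ) (f : ℝ → ℝ) (x : ℝ) (hx : x ∉ tsupport f) : besselOp ν f x = 0 := by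
  have h1 : f =ᶠ[nhds x] fun _ => 0 := notMem_tsupport_iff_eventuallyEq.1 hx
  have h2 : deriv f =ᶠ[nhds x] fun _ => 0 := by simpa using h1.deriv
  rw [besselOp, h2.deriv_eq, h2.eq_of_nhds]; simp

lemma Cc_bessel (ν : ℝ) (f : ℝ → ℝ) (hf : Cc f) : Cc (besselOp ν f) := by
  obtain ⟨h1, h2, h3⟩ := hf
  have hs : tsupport (besselOp ν f) ⊆ tsupport f := by
    refine closure_minimal ?_ (isClosed_tsupport f)
    intro x hx
    by_contra hc
    exact hx (bessel_zero_off ν f x hc)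
  refine ⟨?_, ?_, hs.trans h3⟩
  · rw [contDiff_iff_contDiffAt]
    intro x
    by_cases hx : x ∈ tsupport f
    · have hx0 : x ≠ 0 := ne_of_gt (h3 hx)
      have d1 : ContDiff ℝ (⊤ : ℕ∞) (deriv f) := (contDiff_infty_iff_deriv.1 h1).2
      have d2 : ContDiff ℝ (⊤ : ℕ∞) (deriv (deriv f)) := (contDiff_infty_iff_deriv.1 d1).2
      unfold besselOp
      exact d2.contDiffAt.add ((contDiffAt_const.div contDiffAt_id hx0).mul d1.contDiffAt)
    · have : besselOp ν f =ᶠ[nhds x] fun _ => 0 := by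
        filter_upwards [(isClosed_tsupport f).isOpen_compl.mem_nhds hx] with w hw
        exact bessel_zero_off ν f w hw
      exact contDiffAt_const.congr_of_eventuallyEq this
  · exact h2.of_isClosed_subset (isClosed_tsupport _) hs

lemma Cc_iter (ν : ℝ) (f : ℝ → ℝ) (hf : Cc f) (n : ℕ) : Cc ((besselOp ν)^[n] f) := by
  induction n with
  | zero => exact hf
  | succ n ih => rw [Function.iterate_succ_apply']; exact Cc_bessel ν _ ih

lemma Cc_vanish (f : ℝ → ℝ) (hf : Cc f) : ∃ R, 0 < R ∧ ∀ y, R ≤ y → y ∉ tsupport f := by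
  obtain ⟨R, hR0, hR⟩ := hf.2.1.isCompact.isBounded.subset_closedBall_lt 0 0
  refine ⟨R + 1, by linarith, fun y hy hc => ?_⟩
  have := hR hc
  simp only [Metric.mem_closedBall, dist_zero_right, Real.norm_eq_abs] at this
  linarith [le_abs_self y]

lemma IB_one_bessel (ν : ℝ) (f : ℝ → ℝ) (hf : Cc f) (x : ℝ) (hx : 0 < x) :
    IB ν 1 (besselOp ν f) x = f x := by
  obtain ⟨R, hR0, hR⟩ := Cc_vanish f hf
  set S := max R (x + 1) with hS
  have hxS : x < S := lt_of_lt_of_le (by linarith) (le_max_right _ _)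
  have hS0 : 0 < S := hx.trans hxS
  have hSn : S ∉ tsupport f := hR S (le_max_left _ _)
  have hB := (Cc_bessel ν f hf).1.continuous
  have d0 := (contDiff_infty_iff_deriv.1 hf.1)
  have d1 := (contDiff_infty_iff_deriv.1 d0.2)
  have hfS : f S = 0 := image_eq_zero_of_notMem_tsupport hSn
  have hfS' : deriv f S = 0 := by
    have h1 : f =ᶠ[nhds S] fun _ => 0 := notMem_tsupport_iff_eventuallyEq.1 hSn
    rw [h1.deriv_eq]; simp
  rw [IB_one ν x S hx hxS _ hB.continuousOn
    fun y hy => bessel_zero_off ν f y (hR y ((le_max_left _ _).trans hy))]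
  have hP : ∀ y, 0 < y → ∫ s in S..y, s ^ ν * besselOp ν f s = y ^ ν * deriv f y := by
    intro y hy
    rw [intervalIntegral.integral_eq_sub_of_hasDerivAt (f := fun y => y ^ ν * deriv f y)]
    · simp [hfS']
    · intro w hw
      have hw0 : 0 < w := lt_of_lt_of_le (lt_min hS0 hy) hw.1
      have := (Real.hasDerivAt_rpow_const (x := w) (p := ν) (Or.inl hw0.ne')).mul
        (d1.1 w).hasDerivAt
      refine this.congr_deriv ?_
      rw [besselOp, Real.rpow_sub_one hw0.ne']
      field_simp
      ring
    · exact aux_ii _ ((aux_rpow_cont ν).mul hB.continuousOn) _ _ hS0 hy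
  have : ∫ y in S..x, y ^ (-ν) * ∫ s in S..y, s ^ ν * besselOp ν f s = ∫ y in S..x, deriv f y := by
    refine intervalIntegral.integral_congr fun y hy => ?_
    have hy0 : 0 < y := lt_of_lt_of_le (lt_min hS0 hx) hy.1
    beta_reduce
    rw [hP y hy0, ← mul_assoc, ← Real.rpow_add hy0]; simp
  rw [this, intervalIntegral.integral_deriv_eq_sub (fun y _ => d0.1 y)
    (d0.2.continuous.intervalIntegrable _ _), hfS, sub_zero]

lemma IB_congr (ν a : ℝ) (g h : ℝ → ℝ) (e : EqOn g h (Ioi 0)) : EqOn (IB ν a g) (IB ν a h) (Ioi 0) := by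
  intro x hx
  rw [IB, IB]
  congr 1
  refine setIntegral_congr_fun measurableSet_Ioi fun y hy => ?_
  beta_reduce
  rw [e (lt_trans (show (0:ℝ) < x from hx) hy)]

lemma bessel_congr (ν : ℝ) (g h : ℝ → ℝ) (e : EqOn g h (Ioi 0)) :
    EqOn (besselOp ν g) (besselOp ν h) (Ioi 0) := by
  intro x hx
  have h1 : g =ᶠ[nhds x] h := e.eventuallyEq_of_mem (Ioi_mem_nhds hx)
  rw [besselOp, besselOp, h1.deriv.deriv_eq, h1.deriv_eq]

lemma iter_congr (ν : ℝ) (n : ℕ) (g h : ℝ → ℝ) (e : EqOn g h (Ioi 0)) :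
    EqOn ((besselOp ν)^[n] g) ((besselOp ν)^[n] h) (Ioi 0) := by
  induction n with
  | zero => exact e
  | succ n ih =>
    rw [Function.iterate_succ_apply', Function.iterate_succ_apply']
    exact bessel_congr ν _ _ ih

lemma IB_semi (ν a b : ℝ) (ha : 0 < a) (hb : 0 < b) (g : ℝ → ℝ) (hg : Cc g) :
    EqOn (IB ν a (IB ν b g)) (IB ν (a + b) g) (Ioi 0) := by
  intro x hx
  have := IB_semigroup ν a b ha hb g hg.1.continuous hg.2.1 (-Real.log x)
  rwa [neg_neg, Real.exp_log hx] at this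

lemma bessel_IB (ν a : ℝ) (ha : 0 < a) (f : ℝ → ℝ) (hf : Cc f) :
    EqOn (besselOp ν (IB ν a f)) (IB ν a (besselOp ν f)) (Ioi 0) := by
  have hB := Cc_bessel ν f hf
  have e1 : EqOn (IB ν a f) (IB ν 1 (IB ν a (besselOp ν f))) (Ioi 0) := by
    intro x hx
    rw [← IB_congr ν a _ _ (fun y hy => IB_one_bessel ν f hf y hy) hx,
      IB_semi ν a 1 ha one_pos _ hB hx, IB_semi ν 1 a one_pos ha _ hB hx, add_comm]
  intro x hx
  obtain ⟨R, hR0, hR⟩ := Cc_vanish _ hB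
  rw [bessel_congr ν _ _ e1 hx]
  refine bessel_IB_one ν R _ (IB_continuousOn ν a ha _ hB.1.continuous hB.2.1) ?_ x hx
  intro y hy
  rw [IB, setIntegral_eq_zero_of_forall_eq_zero, mul_zero]
  intro w hw
  rw [image_eq_zero_of_notMem_tsupport (hR w (hy.trans (le_of_lt hw))), mul_zero]

lemma iter_IB (ν a : ℝ) (ha : 0 < a) (n : ℕ) (f : ℝ → ℝ) (hf : Cc f) :
    EqOn ((besselOp ν)^[n] (IB ν a f)) (IB ν a ((besselOp ν)^[n] f)) (Ioi 0) := by
  induction n generalizing f with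
  | zero => exact fun _ _ => rfl
  | succ n ih =>
    intro x hx
    rw [Function.iterate_succ_apply, Function.iterate_succ_apply,
      iter_congr ν n _ _ (bessel_IB ν a ha f hf) hx]
    exact ih _ (Cc_bessel ν f hf) hx

theorem DB_semigroup (ν α β : ℝ) (hν : 0 ≤ ν) (hα : 0 < α) (hβ : 0 < β)
    (f : ℝ → ℝ) (hf : ContDiff ℝ (⊤ : ℕ∞) f) (hsupp : HasCompactSupport f)
    (hsupp' : tsupport f ⊆ Ioi (0 : ℝ)) :
    ∀ x : ℝ, 0 < x → DB ν α (DB ν β f) x = DB ν (α + β) f x := by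
  intro x hx
  have hC : Cc f := ⟨hf, hsupp, hsupp'⟩
  have pos : ∀ γ : ℝ, 0 < ((⌊γ⌋₊ + 1 : ℕ) : ℝ) - γ := fun γ => by
    have := Nat.lt_floor_add_one γ
    push_cast; linarith
  have hDB : ∀ γ : ℝ, EqOn (DB ν γ f)
      (IB ν ((⌊γ⌋₊ + 1 : ℕ) - γ) ((besselOp ν)^[⌊γ⌋₊ + 1] f)) (Ioi 0) := fun γ =>
    iter_IB ν _ (pos γ) _ f hC
  rw [hDB (α + β) hx]
  have hCn := Cc_iter ν f hC (⌊β⌋₊ + 1)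
  have hsum : 0 < ((⌊α⌋₊ + 1 : ℕ) : ℝ) - α + (((⌊β⌋₊ + 1 : ℕ) : ℝ) - β) := add_pos (pos α) (pos β)
  have e1 : DB ν α (DB ν β f) x =
      IB ν (((⌊α⌋₊ + 1 : ℕ) : ℝ) - α + (((⌊β⌋₊ + 1 : ℕ) : ℝ) - β))
        ((besselOp ν)^[(⌊α⌋₊ + 1) + (⌊β⌋₊ + 1)] f) x := by
    rw [DB, iter_congr ν _ _ _ ((IB_congr ν _ _ _ (hDB β)).trans
      (IB_semi ν _ _ (pos α) (pos β) _ hCn)) hx, iter_IB ν _ hsum _ _ hCn hx,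
      Function.iterate_add_apply (besselOp ν) (⌊α⌋₊ + 1) (⌊β⌋₊ + 1) f]
  rw [e1]
  have fa := Nat.floor_le hα.le
  have fb := Nat.floor_le hβ.le
  have fa' := Nat.lt_floor_add_one α
  have fb' := Nat.lt_floor_add_one β
  have hcase : ⌊α + β⌋₊ = ⌊α⌋₊ + ⌊β⌋₊ ∨ ⌊α + β⌋₊ = ⌊α⌋₊ + ⌊β⌋₊ + 1 := by
    rcases lt_or_ge (α + β) (⌊α⌋₊ + ⌊β⌋₊ + 1) with h | h
    · left
      rw [Nat.floor_eq_iff (by positivity)]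
      push_cast
      constructor <;> linarith
    · right
      rw [Nat.floor_eq_iff (by positivity)]
      push_cast
      constructor <;> linarith
  have hp := pos (α + β)
  rcases hcase with h | h
  · rw [h] at hp ⊢
    have hCk := Cc_iter ν f hC (⌊α⌋₊ + ⌊β⌋₊ + 1)
    rw [show (⌊α⌋₊ + 1) + (⌊β⌋₊ + 1) = (⌊α⌋₊ + ⌊β⌋₊ + 1) + 1 by ring, Function.iterate_succ_apply',
      show ((⌊α⌋₊ + 1 : ℕ) : ℝ) - α + (((⌊β⌋₊ + 1 : ℕ) : ℝ) - β) =
        (((⌊α⌋₊ + ⌊β⌋₊ + 1 : ℕ) : ℝ) - (α + β)) + 1 by push_cast; ring,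
      ← IB_semi ν _ 1 hp one_pos _ (Cc_bessel ν _ hCk) hx,
      IB_congr ν _ _ _ (fun y hy => IB_one_bessel ν _ hCk y hy) hx]
  · rw [h, show (⌊α⌋₊ + 1) + (⌊β⌋₊ + 1) = (⌊α⌋₊ + ⌊β⌋₊ + 1) + 1 by ring]
    congr 1
    push_cast; ring
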